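/- For every v ∈ {0,1}^n, the map M_{−v} → Hom_R(M_v, R) sending u to the multiplication map m ↦ u·m (which indeed takes values in R, since the product of an element of S_{−v + c·1} and an element of S_{v + c'·1} lies in S_{(c+c')·1} = R_{c+c'}) is an isomorphism of R-modules. -/

import Mathlib

open MvPolynomial

noncomputable section

variable (k : Type*) [Field k] (n : ℕ)

/-- The polynomial ring `S = k[x_1, y_1, …, x_n, y_n]`; the variable `(i, 0)` represents
`x_i` and `(i, 1)` represents `y_i`. -/
abbrev SegreAmbient := MvPolynomial (Fin n × Fin 2) k

/-- The `ℤ^n`-grading: `deg x_i = deg y_i = e_i`, the `i`-th standard basis vector. -/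
def segreWeight : Fin n × Fin 2 → (Fin n → ℤ) := fun p => Pi.single p.1 1

/-- The homogeneous component `S_v` of multidegree `v ∈ ℤ^n`. -/
def SegreGrade (v : Fin n → ℤ) : Submodule k (SegreAmbient k n) :=
  weightedHomogeneousSubmodule k (segreWeight n) v

/-- `M_v = ⊕_{c ∈ ℤ} S_{v + c·1}`, as a `k`-submodule of `S`. -/
def SegreMod (v : Fin n → ℤ) : Submodule k (SegreAmbient k n) where
  carrier := {x | ∀ d ∈ x.support,
    ∃ c : ℤ, (Finsupp.weight (segreWeight n)) d = v + c • (1 : Fin n → ℤ)}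
  add_mem' := by
    intro a b ha hb d hd
    rcases Finset.mem_union.mp (MvPolynomial.support_add hd) with h | h
    · exact ha d h
    · exact hb d h
  zero_mem' := by simp
  smul_mem' := by
    intro r x hx d hd
    exact hx d (MvPolynomial.support_smul hd)

/-- The Segre product `R = ⊕_{c ∈ ℤ} S_{c·1}` (the diagonal Veronese subring of `S`),
as a subalgebra of `S`. -/
def SegreRing : Subalgebra k (SegreAmbient k n) where
  carrier := SegreMod k n 0
  add_mem' := fun ha hb => (SegreMod k n 0).add_mem ha hb
  zero_mem' := (SegreMod k n 0).zero_mem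
  one_mem' := by
    intro d hd
    rw [MvPolynomial.mem_support_iff, MvPolynomial.coeff_one] at hd
    have hd0 : d = 0 := by
      by_contra hc
      rw [if_neg (fun h : (0 : Fin n × Fin 2 →₀ ℕ) = d => hc h.symm)] at hd
      exact hd rfl
    exact ⟨0, by simp [hd0]⟩
  mul_mem' := by
    intro a b ha hb d hd
    obtain ⟨u, hu, v, hv, rfl⟩ := Finset.mem_add.mp (MvPolynomial.support_mul a b hd)
    obtain ⟨c1, hc1⟩ := ha u hu
    obtain ⟨c2, hc2⟩ := hb v hv
    exact ⟨c1 + c2, by rw [map_add, hc1, hc2]; module⟩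
  algebraMap_mem' := by
    intro r d hd
    rw [MvPolynomial.mem_support_iff, MvPolynomial.algebraMap_eq, MvPolynomial.coeff_C] at hd
    have hd0 : d = 0 := by
      by_contra hc
      rw [if_neg (fun h : (0 : Fin n × Fin 2 →₀ ℕ) = d => hc h.symm)] at hd
      exact hd rfl
    exact ⟨0, by simp [hd0]⟩

/-- `M_v` as a module over the Segre product `R`, i.e. as an `R`-submodule of `S`. -/
def SegreRMod (v : Fin n → ℤ) : Submodule (SegreRing k n) (SegreAmbient k n) where
  carrier := SegreMod k n v
  add_mem' := fun ha hb => (SegreMod k n v).add_mem ha hb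
  zero_mem' := (SegreMod k n v).zero_mem
  smul_mem' := by
    intro r x hx d hd
    have hd' : d ∈ ((r : SegreAmbient k n) * x).support := hd
    obtain ⟨u, hu, w, hw, rfl⟩ :=
      Finset.mem_add.mp (MvPolynomial.support_mul (r : SegreAmbient k n) x hd')
    obtain ⟨c1, hc1⟩ := r.2 u hu
    obtain ⟨c2, hc2⟩ := hx w hw
    exact ⟨c1 + c2, by rw [map_add, hc1, hc2]; module⟩

theorem segre_mul_mem {v w z : Fin n → ℤ} (hz : ∃ c : ℤ, v + w = z + c • (1 : Fin n → ℤ))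
    {a b : SegreAmbient k n}
    (ha : a ∈ SegreMod k n v) (hb : b ∈ SegreMod k n w) : a * b ∈ SegreMod k n z := by
  intro d hd
  obtain ⟨s, hs, t, ht, rfl⟩ := Finset.mem_add.mp (MvPolynomial.support_mul a b hd)
  obtain ⟨c1, hc1⟩ := ha s hs
  obtain ⟨c2, hc2⟩ := hb t ht
  obtain ⟨c, hc⟩ := hz
  refine ⟨c + c1 + c2, ?_⟩
  rw [map_add, hc1, hc2]
  have : v + c1 • (1 : Fin n → ℤ) + (w + c2 • (1 : Fin n → ℤ))
    = (v + w) + (c1 + c2) • (1 : Fin n → ℤ) := by module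
  rw [this, hc]
  module

/-- The exponent of the monomial with exponent `a i` at the variable `(i, j)`. -/
def segreExpo (a : Fin n → ℕ) (j : Fin 2) : Fin n × Fin 2 →₀ ℕ :=
  ∑ i, Finsupp.single (i, j) (a i)

theorem segreExpo_weight (a : Fin n → ℕ) (j : Fin 2) :
    Finsupp.weight (segreWeight n) (segreExpo n a j) = fun i => (a i : ℤ) := by
  funext i
  simp [segreExpo, map_sum, Finsupp.weight_single, segreWeight, Pi.single_apply]

theorem segre_monomial_eq (a : Fin n → ℕ) (j : Fin 2) :
    (monomial (segreExpo n a j) (1 : k)) = ∏ i, (X (i, j) : SegreAmbient k n) ^ (a i) := by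
  rw [segreExpo, monomial_sum_one]
  simp [X_pow_eq_monomial]

theorem segre_relprime (a : Fin n → ℕ) :
    IsRelPrime (monomial (segreExpo n a 0) (1 : k)) (monomial (segreExpo n a 1) (1 : k)) := by
  rw [segre_monomial_eq, segre_monomial_eq]
  refine IsRelPrime.prod_left fun i _ => IsRelPrime.prod_right fun j _ => ?_
  refine IsRelPrime.pow ?_
  rw [Irreducible.isRelPrime_iff_not_dvd (MvPolynomial.X_prime).irreducible]
  rw [MvPolynomial.X_dvd_X]
  simp

theorem segre_monomial_mem (a : Fin n → ℕ) (j : Fin 2) (v : Fin n → ℤ)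
    (h : ∃ c : ℤ, (fun i => (a i : ℤ)) = v + c • (1 : Fin n → ℤ)) :
    (monomial (segreExpo n a j) (1 : k)) ∈ SegreMod k n v := by
  intro d hd
  have : d = segreExpo n a j := by
    have := MvPolynomial.support_monomial_subset hd
    simpa using this
  subst this
  rw [segreExpo_weight]
  exact h

theorem segre_mem_of_mul (a : Fin n → ℕ) (v : Fin n → ℤ) (h : ∀ i, (a i : ℤ) = v i)
    (u : SegreAmbient k n) (hu : u * monomial (segreExpo n a 0) (1 : k) ∈ SegreMod k n 0) :
    u ∈ SegreMod k n (-v) := by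
  intro d hd
  have h1 : d + segreExpo n a 0 ∈ (u * monomial (segreExpo n a 0) (1 : k)).support := by
    rw [mem_support_iff] at hd ⊢
    rw [coeff_mul_monomial]
    simpa using hd
  obtain ⟨c, hc⟩ := hu _ h1
  refine ⟨c, ?_⟩
  rw [map_add, segreExpo_weight, funext h] at hc
  rw [eq_sub_of_add_eq hc]
  abel

set_option synthInstance.maxHeartbeats 1000000 in
set_option maxHeartbeats 2000000 in
theorem segre_hom_symm (v : Fin n → ℤ) (hv : ∀ i, v i = 0 ∨ v i = 1)
    (f : ↥(SegreRMod k n v) →ₗ[SegreRing k n] SegreRing k n) (m m' : ↥(SegreRMod k n v)) :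
    (m : SegreAmbient k n) * (f m' : SegreAmbient k n) = m' * (f m : SegreAmbient k n) := by
  set w : SegreAmbient k n := monomial (segreExpo n (fun i => (1 - v i).toNat) 0) (1 : k) with hw
  have hwm : w ∈ SegreMod k n (-v) := by
    refine segre_monomial_mem k n _ _ _ ⟨1, ?_⟩
    funext i
    rcases hv i with h | h <;> simp [h]
  have hw0 : w ≠ 0 := by simp [hw]
  have key : ∀ x : ↥(SegreRMod k n v), w * (x : SegreAmbient k n) ∈ SegreRing k n := fun x =>
    segre_mul_mem k n ⟨0, by simp⟩ hwm x.2
  have e : (⟨w * m, key m⟩ : SegreRing k n) • m' = (⟨w * m', key m'⟩ : SegreRing k n) • m := by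
    apply Subtype.ext
    change w * (m : SegreAmbient k n) * m' = w * m' * m
    ring
  have e2 := congrArg f e
  rw [map_smul, map_smul] at e2
  have e3 : w * (m : SegreAmbient k n) * (f m' : SegreAmbient k n)
    = w * m' * (f m : SegreAmbient k n) := congrArg Subtype.val e2
  rw [mul_assoc, mul_assoc] at e3
  exact mul_left_cancel₀ hw0 e3

theorem segre_hom_exists (v : Fin n → ℤ) (hv : ∀ i, v i = 0 ∨ v i = 1)
    (f : ↥(SegreRMod k n v) →ₗ[SegreRing k n] SegreRing k n) :
    ∃ u : SegreAmbient k n, u ∈ SegreMod k n (-v) ∧ ∀ m : ↥(SegreRMod k n v),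
      (f m : SegreAmbient k n) = u * m := by
  have ha : ∀ i, ((v i).toNat : ℤ) = v i := fun i => by rcases hv i with h | h <;> simp [h]
  have hm : ∀ j, (monomial (segreExpo n (fun i => (v i).toNat) j) (1 : k)) ∈ SegreMod k n v :=
    fun j => segre_monomial_mem k n _ _ _ ⟨0, by funext i; simp [ha]⟩
  let p : ↥(SegreRMod k n v) := ⟨_, hm 0⟩
  let q : ↥(SegreRMod k n v) := ⟨_, hm 1⟩
  have hp0 : (p : SegreAmbient k n) ≠ 0 := by simp [p]
  have hdvd : (p : SegreAmbient k n) ∣ (f p : SegreAmbient k n) := by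
    have h1 := segre_hom_symm k n v hv f p q
    exact (segre_relprime k n (fun i => (v i).toNat)).dvd_of_dvd_mul_left (Dvd.intro _ h1)
  obtain ⟨u, hu⟩ := hdvd
  refine ⟨u, segre_mem_of_mul k n (fun i => (v i).toNat) v ha u ?_, fun m => ?_⟩
  · have := (f p).2
    rw [hu, mul_comm] at this
    exact this
  · have h1 := segre_hom_symm k n v hv f p m
    rw [hu] at h1
    apply mul_left_cancel₀ hp0
    rw [h1]
    ring

/-- Multiplication by `u ∈ M_{-v}` as a homomorphism `M_v → R`. -/
def segreMulHom (v : Fin n → ℤ) (u : ↥(SegreRMod k n (-v))) :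
    ↥(SegreRMod k n v) →ₗ[SegreRing k n] SegreRing k n where
  toFun m := ⟨(u : SegreAmbient k n) * m, segre_mul_mem k n ⟨0, by simp⟩ u.2 m.2⟩
  map_add' a b := Subtype.ext (mul_add (u : SegreAmbient k n) a b)
  map_smul' r a := Subtype.ext (mul_left_comm (u : SegreAmbient k n) r a)

/-- The map `M_{-v} → Hom_R(M_v, R)`. -/
def segrePhi (v : Fin n → ℤ) : ↥(SegreRMod k n (-v)) →ₗ[SegreRing k n]
    (↥(SegreRMod k n v) →ₗ[SegreRing k n] SegreRing k n) where
  toFun u := segreMulHom k n v u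
  map_add' a b := LinearMap.ext fun m => Subtype.ext (add_mul (a : SegreAmbient k n) b m)
  map_smul' r a := LinearMap.ext fun m => Subtype.ext (mul_assoc (r : SegreAmbient k n) a m)

set_option synthInstance.maxHeartbeats 1000000 in
set_option maxHeartbeats 2000000 in
/--
For every `v ∈ {0,1}^n`, the map `M_{−v} → Hom_R(M_v, R)` sending `u` to the
multiplication map `m ↦ u·m` (which indeed takes values in `R`) is an isomorphism of
`R`-modules.
-/
theorem stmt6 (hn : 1 ≤ n) (v : Fin n → ℤ) (hv : ∀ i, v i = 0 ∨ v i = 1) :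
    ∃ Φ : ↥(SegreRMod k n (-v)) ≃ₗ[SegreRing k n]
        (↥(SegreRMod k n v) →ₗ[SegreRing k n] SegreRing k n),
      ∀ (u : ↥(SegreRMod k n (-v))) (m : ↥(SegreRMod k n v)),
        ((Φ u m : SegreRing k n) : SegreAmbient k n) =
          (u : SegreAmbient k n) * (m : SegreAmbient k n) := by
  refine ⟨LinearEquiv.ofBijective (segrePhi k n v) ⟨?_, ?_⟩, fun u m => rfl⟩
  · intro a b hab
    have hm : (monomial (segreExpo n (fun i => (v i).toNat) 0) (1 : k)) ∈ SegreMod k n v :=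
      segre_monomial_mem k n _ _ _
        ⟨0, by funext i; rcases hv i with h | h <;> simp [h]⟩
    have h1 := congrArg Subtype.val (LinearMap.congr_fun hab ⟨_, hm⟩)
    exact Subtype.ext (mul_right_cancel₀ (by simp) h1)
  · intro f
    obtain ⟨u, hu, h⟩ := segre_hom_exists k n v hv f
    exact ⟨⟨u, hu⟩, LinearMap.ext fun m => Subtype.ext (h m).symm⟩


end
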